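/- arXiv:2401.04356 — 9 statements merged into one kernel-verified Lean document; each statement's English description precedes it below -/
import Mathlib

section
/- Let P be a clean lattice parallelogram in ℝ² with area(P) = n, where n is a positive integer. Then the topological interior of P contains exactly n − 1 lattice points. -/
/-- The set of lattice points of `ℝ²`. -/
def latt : Set (ℝ × ℝ) := {p | ∃ z : ℤ × ℤ, p = ((z.1 : ℝ), (z.2 : ℝ))}

/-- The canonical embedding `ℤ² → ℝ²`. -/
def c (z : ℤ × ℤ) : ℝ × ℝ := ((z.1 : ℝ), (z.2 : ℝ))

/-- The cross product (oriented area) of two integer vectors. -/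
def cross (p q : ℤ × ℤ) : ℤ := p.1 * q.2 - p.2 * q.1

/-- If the only lattice points on the boundary of the parallelogram spanned by `u` and `v` are its
vertices, then `u` is a primitive vector. -/
lemma isCoprime_of_clean (u v : ℤ × ℤ) (hD : 0 < cross u v)
    (hclean : ∀ z : ℤ × ℤ, 0 ≤ cross z v → cross z v ≤ cross u v → 0 ≤ cross u z →
      cross u z ≤ cross u v → (cross z v = 0 ∨ cross z v = cross u v ∨ cross u z = 0 ∨
        cross u z = cross u v) → z = 0 ∨ z = u ∨ z = v ∨ z = u + v) :
    IsCoprime u.1 u.2 := by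
  obtain ⟨a, b⟩ := u
  obtain ⟨p, q⟩ := v
  rw [Int.isCoprime_iff_gcd_eq_one]
  obtain ⟨a', ha⟩ : (Int.gcd a b : ℤ) ∣ a := Int.gcd_dvd_left ..
  obtain ⟨b', hb⟩ : (Int.gcd a b : ℤ) ∣ b := Int.gcd_dvd_right ..
  change Int.gcd a b = 1
  generalize Int.gcd a b = g at *
  subst ha hb
  simp only [cross] at *
  have hfac : (g : ℤ) * a' * q - g * b' * p = g * (a' * q - b' * p) := by ring
  have hg : (0 : ℤ) < g := by
    rcases Nat.eq_zero_or_pos g with h | h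
    · subst h; simp at hD
    · exact_mod_cast h
  have hE : 0 < a' * q - b' * p := by
    rw [hfac] at hD; exact pos_of_mul_pos_right hD hg.le
  have hz : (g : ℤ) * a' * b' - g * b' * a' = 0 := by ring
  have key := hclean (a', b') hE.le (by rw [hfac]; nlinarith) (by simp only [hz]; exact le_rfl)
    (by simp only [hz]; exact hD.le) (Or.inr (Or.inr (Or.inl hz)))
  simp only [Prod.mk_add_mk, Prod.mk.injEq, Prod.mk_eq_zero] at key
  rcases key with ⟨h1, h2⟩ | ⟨h1, h2⟩ | ⟨h1, h2⟩ | ⟨h1, h2⟩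
  · subst h1 h2; simp at hE
  · have h3 : ((g : ℤ) - 1) * (a' * q - b' * p) = 0 := by linear_combination (-q) * h1 + p * h2
    rcases mul_eq_zero.1 h3 with h | h
    · omega
    · omega
  · subst h1 h2; exact absurd hE (by rw [mul_comm]; simp)
  · have h3 : a' * q - b' * p = 0 := by
      have h4 : (g : ℤ) * (a' * q - b' * p) = 0 := by
        linear_combination (-(g : ℤ) * a') * h2 + (g : ℤ) * b' * h1
      rcases mul_eq_zero.1 h4 with h | h <;> omega
    omega

/-- A clean positively oriented parallelogram at the origin of area `D` has `D - 1` interior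
lattice points, written in terms of cross products. -/
lemma ncard_interior_of_clean (u v : ℤ × ℤ) (hD : 0 < cross u v)
    (hclean : ∀ z : ℤ × ℤ, 0 ≤ cross z v → cross z v ≤ cross u v → 0 ≤ cross u z →
      cross u z ≤ cross u v → (cross z v = 0 ∨ cross z v = cross u v ∨ cross u z = 0 ∨
        cross u z = cross u v) → z = 0 ∨ z = u ∨ z = v ∨ z = u + v) :
    {z : ℤ × ℤ | (0 < cross z v ∧ cross z v < cross u v) ∧
      0 < cross u z ∧ cross u z < cross u v}.ncard = (cross u v).toNat - 1 := by
  obtain ⟨x, y, hxy⟩ := isCoprime_of_clean u v hD hclean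
  have himg : cross u '' {z : ℤ × ℤ | (0 < cross z v ∧ cross z v < cross u v) ∧
      0 < cross u z ∧ cross u z < cross u v} = Finset.Ioo 0 (cross u v) := by
    ext k
    simp only [Set.mem_image, Set.mem_ofPred_eq, Finset.coe_Ioo, Set.mem_Ioo]
    constructor
    · rintro ⟨z, ⟨-, h⟩, rfl⟩
      exact h
    · rintro ⟨hk0, hkD⟩
      set z₀ : ℤ × ℤ := (-(k * y), k * x) with hz₀
      set m : ℤ := cross z₀ v / cross u v with hm
      set z : ℤ × ℤ := (z₀.1 - m * u.1, z₀.2 - m * u.2) with hz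
      have hB : cross u z = k := by
        simp only [hz, hz₀, cross]; linear_combination k * hxy
      have hA : cross z v = cross z₀ v % cross u v := by
        rw [Int.emod_def, ← hm]; simp only [hz, cross]; ring
      have h0 : 0 ≤ cross z v := hA ▸ Int.emod_nonneg _ hD.ne'
      have h1 : cross z v < cross u v := hA ▸ Int.emod_lt_of_pos _ hD
      refine ⟨z, ⟨⟨lt_of_le_of_ne h0 fun h => ?_, h1⟩, by omega, by omega⟩, hB⟩
      have huu : cross u u = 0 := by simp only [cross]; ring
      have hu0 : cross u 0 = 0 := by simp [cross]
      have huv : cross u (u + v) = cross u v := by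
        simp only [cross, Prod.fst_add, Prod.snd_add]; ring
      rcases hclean z h0 h1.le (by omega) (by omega) (Or.inl h.symm) with e | e | e | e <;>
        rw [e] at hB <;> omega
  have hinj : Set.InjOn (cross u) {z : ℤ × ℤ | (0 < cross z v ∧ cross z v < cross u v) ∧
      0 < cross u z ∧ cross u z < cross u v} := by
    rintro z ⟨⟨hz0, hz1⟩, -⟩ z' ⟨⟨hz0', hz1'⟩, -⟩ h
    set m : ℤ := x * (z.1 - z'.1) + y * (z.2 - z'.2) with hm
    have h1 : z.1 - z'.1 = m * u.1 := by
      simp only [cross] at h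
      linear_combination (-(z.1 - z'.1)) * hxy - y * h
    have h2 : z.2 - z'.2 = m * u.2 := by
      simp only [cross] at h
      linear_combination (-(z.2 - z'.2)) * hxy + x * h
    have hA : cross z v - cross z' v = m * cross u v := by
      simp only [cross]; linear_combination v.2 * h1 - v.1 * h2
    have hm0 : m = 0 := by
      have : m < 1 := by by_contra hc; nlinarith
      have : -1 < m := by by_contra hc; nlinarith
      omega
    rw [hm0] at h1 h2
    ext <;> omega
  rw [← hinj.ncard_image, himg, Set.ncard_coe_finset, Int.card_Ioo]
  omega

/-- The linear map `(s, t) ↦ s u + t v`. -/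
noncomputable def spanMap (u v : ℤ × ℤ) : ℝ × ℝ →ₗ[ℝ] ℝ × ℝ :=
  Matrix.toLin (Module.Basis.finTwoProd ℝ) (Module.Basis.finTwoProd ℝ)
    !![(u.1 : ℝ), (v.1 : ℝ); (u.2 : ℝ), (v.2 : ℝ)]

lemma spanMap_apply (u v : ℤ × ℤ) (x : ℝ × ℝ) :
    spanMap u v x = (u.1 * x.1 + v.1 * x.2, u.2 * x.1 + v.2 * x.2) :=
  Matrix.toLin_finTwoProd_apply ..

lemma det_spanMap (u v : ℤ × ℤ) : LinearMap.det (spanMap u v) = (cross u v : ℝ) := by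
  rw [spanMap, LinearMap.det_toLin, Matrix.det_fin_two_of]
  simp only [cross]; push_cast; ring

/-- A parallelogram is the image of the unit square under the affine map
`(s, t) ↦ w + s u + t v`. -/
lemma convexHull_eq_image_square (w u v : ℤ × ℤ) :
    convexHull ℝ ({c w, c (w + u), c (w + v), c (w + u + v)} : Set (ℝ × ℝ)) =
      (fun p => c w + p) '' (spanMap u v '' (Set.Icc 0 1 ×ˢ Set.Icc 0 1)) := by
  have hsq : (Set.Icc 0 1 ×ˢ Set.Icc 0 1 : Set (ℝ × ℝ)) =
      convexHull ℝ ({0, 1} ×ˢ {0, 1}) := by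
    rw [convexHull_prod, convexHull_pair, segment_eq_Icc zero_le_one]
  rw [hsq, LinearMap.image_convexHull,
    ← Set.singleton_add, ← convexHull_singleton (𝕜 := ℝ) (c w), ← convexHull_add,
    Set.singleton_add]
  congr 1
  simp only [Set.insert_prod, Set.singleton_prod, Set.image_insert_eq, Set.image_union,
    Set.image_singleton, spanMap_apply]
  ext p
  simp [c, add_assoc]
  tauto

/-- The affine homeomorphism `(s, t) ↦ w + s u + t v`. -/
noncomputable def spanHomeomorph (w u v : ℤ × ℤ) (h : cross u v ≠ 0) : ℝ × ℝ ≃ₜ ℝ × ℝ :=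
  (LinearMap.equivOfDetNeZero (spanMap u v)
    (by rw [det_spanMap]; exact_mod_cast h)).toContinuousLinearEquiv.toHomeomorph.trans
    (Homeomorph.addLeft (c w))

lemma spanHomeomorph_apply (w u v : ℤ × ℤ) (h : cross u v ≠ 0) (x : ℝ × ℝ) :
    spanHomeomorph w u v h x = c w + spanMap u v x := rfl

/-- A lattice point `w + z` lies in the image of `S` under `(s, t) ↦ w + s u + t v` exactly when
its coordinates, computed by Cramer's rule, lie in `S`. -/
lemma c_add_mem_image_iff (w u v : ℤ × ℤ) (h : cross u v ≠ 0) (S : Set (ℝ × ℝ)) (z : ℤ × ℤ) :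
    c (w + z) ∈ spanHomeomorph w u v h '' S ↔
      ((cross z v : ℝ) / cross u v, (cross u z : ℝ) / cross u v) ∈ S := by
  have hD : (cross u v : ℝ) ≠ 0 := by exact_mod_cast h
  have he : spanHomeomorph w u v h ((cross z v : ℝ) / cross u v, (cross u z : ℝ) / cross u v)
      = c (w + z) := by
    rw [spanHomeomorph_apply, spanMap_apply]
    ext
    · simp only [c, Prod.fst_add, Int.cast_add, add_right_inj]
      field_simp
      simp only [cross]; push_cast; ring
    · simp only [c, Prod.snd_add, Int.cast_add, add_right_inj]
      field_simp
      simp only [cross]; push_cast; ring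
  rw [← he, (spanHomeomorph w u v h).injective.mem_set_image]

lemma c_injective : Function.Injective c := fun a b h => by
  simp only [c, Prod.mk.injEq, Int.cast_inj] at h
  exact Prod.ext h.1 h.2

lemma volume_parallelogram (w u v : ℤ × ℤ) :
    MeasureTheory.volume
      (convexHull ℝ ({c w, c (w + u), c (w + v), c (w + u + v)} : Set (ℝ × ℝ))) =
      ((cross u v).natAbs : ENNReal) := by
  rw [convexHull_eq_image_square, Set.image_add_left, MeasureTheory.measure_preimage_add,
    MeasureTheory.Measure.addHaar_image_linearMap, det_spanMap,
    MeasureTheory.Measure.volume_eq_prod, MeasureTheory.Measure.prod_prod]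
  simp only [Real.volume_Icc, sub_zero, ENNReal.ofReal_one, mul_one]
  rw [← Int.cast_abs, Int.abs_eq_natAbs, Int.cast_natCast, ENNReal.ofReal_natCast]

lemma ncard_interior_of_cross_pos (w u v : ℤ × ℤ) (hD : 0 < cross u v) (P : Set (ℝ × ℝ))
    (hP : P = convexHull ℝ ({c w, c (w + u), c (w + v), c (w + u + v)} : Set (ℝ × ℝ)))
    (hclean : frontier P ∩ latt = {c w, c (w + u), c (w + v), c (w + u + v)}) :
    (interior P ∩ latt).ncard = (cross u v).toNat - 1 := by
  have hDR : (0 : ℝ) < cross u v := by exact_mod_cast hD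
  have hPi : P = spanHomeomorph w u v hD.ne' '' (Set.Icc 0 1 ×ˢ Set.Icc 0 1) := by
    rw [hP, convexHull_eq_image_square, Set.image_image]; rfl
  rw [← ncard_interior_of_clean u v hD ?_]
  · have hinj : Function.Injective fun z : ℤ × ℤ => c (w + z) :=
      c_injective.comp (add_right_injective w)
    rw [← Set.ncard_image_of_injective _ hinj]
    congr 1
    have hmem : ∀ z, c (w + z) ∈ interior P ↔ (0 < cross z v ∧ cross z v < cross u v) ∧
        0 < cross u z ∧ cross u z < cross u v := fun z => by
      rw [hPi, ← Homeomorph.image_interior, c_add_mem_image_iff, interior_prod_eq, interior_Icc]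
      simp only [Set.mem_prod, Set.mem_Ioo, div_pos_iff_of_pos_right hDR, div_lt_one hDR,
        Int.cast_pos, Int.cast_lt]
    ext p
    constructor
    · rintro ⟨hp, z, rfl⟩
      refine ⟨z - w, (hmem _).1 ?_, ?_⟩ <;> simp only [add_sub_cancel]
      · exact hp
      · rfl
    · rintro ⟨z, hz, rfl⟩
      exact ⟨(hmem z).2 hz, w + z, rfl⟩
  · intro z h0 h1 h2 h3 h
    have hz : c (w + z) ∈ frontier P ∩ latt := by
      refine ⟨?_, w + z, rfl⟩
      rw [hPi, ← Homeomorph.image_frontier, c_add_mem_image_iff, frontier_prod_eq,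
        frontier_Icc zero_le_one, isClosed_Icc.closure_eq]
      simp only [Set.mem_union, Set.mem_prod, Set.mem_Icc, Set.mem_insert_iff,
        Set.mem_singleton_iff, div_eq_zero_iff, div_eq_one_iff_eq hDR.ne', hDR.ne', or_false,
        Int.cast_eq_zero, Int.cast_inj, div_le_one hDR, le_div_iff₀ hDR, zero_mul,
        Int.cast_nonneg_iff, Int.cast_le]
      tauto
    rw [hclean] at hz
    simp only [Set.mem_insert_iff, Set.mem_singleton_iff, c_injective.eq_iff, add_assoc,
      add_right_inj, add_eq_left] at hz
    exact hz

/-- A clean lattice parallelogram of area `n` has exactly `n - 1` lattice points in its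
topological interior. -/
theorem stmt_2 (w u v : ℤ × ℤ) (n : ℕ) (hn : 0 < n) (P : Set (ℝ × ℝ))
    (hP : P = convexHull ℝ ({c w, c (w + u), c (w + v), c (w + u + v)} : Set (ℝ × ℝ)))
    (hind : u.1 * v.2 - u.2 * v.1 ≠ 0)
    (harea : MeasureTheory.volume P = (n : ENNReal))
    (hclean : frontier P ∩ latt = {c w, c (w + u), c (w + v), c (w + u + v)}) :
    (interior P ∩ latt).ncard = n - 1 := by
  have hn' : (cross u v).natAbs = n := by
    rw [hP, volume_parallelogram] at harea
    exact_mod_cast harea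
  have hcomm : cross v u = -cross u v := by simp only [cross]; ring
  rcases lt_or_gt_of_ne (show cross u v ≠ 0 from hind) with hneg | hpos
  · have hset : ({c w, c (w + u), c (w + v), c (w + u + v)} : Set (ℝ × ℝ)) =
        {c w, c (w + v), c (w + u), c (w + v + u)} := by
      rw [Set.insert_comm (c (w + u)), add_right_comm]
    rw [hset] at hP hclean
    rw [ncard_interior_of_cross_pos w v u (by omega) P hP hclean]
    omega
  · rw [ncard_interior_of_cross_pos w u v hpos P hP hclean]
    omega
end

section
/- Let a, n be positive integers with a < n, n > 1 and gcd(a,n) = 1, and let a⁻¹ be the unique integer with 0 < a⁻¹ < n and a·a⁻¹ ≡ 1 (mod n). Then the four clean parallelograms P_{a,n}, P_{n−a,n}, P_{a⁻¹,n}, P_{n−a⁻¹,n} are pairwise unimodularly equivalent. -/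
/-- The clean lattice parallelogram with vertices `(0,0), (1,0), (a,n), (a+1,n)`. -/
noncomputable def Pan (a n : ℕ) : Set (ℝ × ℝ) :=
  convexHull ℝ ({(0, 0), (1, 0), ((a : ℝ), (n : ℝ)), ((a : ℝ) + 1, (n : ℝ))} : Set (ℝ × ℝ))

/-- `P` and `Q` are unimodularly equivalent: `Q` is the image of `P` under an affine map
`x ↦ Mx + w` with `M` an integer matrix of determinant `±1` and `w ∈ ℤ²`. -/
def UnimodEquiv (P Q : Set (ℝ × ℝ)) : Prop :=
  ∃ (M : Matrix (Fin 2) (Fin 2) ℤ) (w : ℤ × ℤ),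
    (M.det = 1 ∨ M.det = -1) ∧
    (fun p : ℝ × ℝ =>
        (((M 0 0 : ℝ) * p.1 + (M 0 1 : ℝ) * p.2 + (w.1 : ℝ)),
         ((M 1 0 : ℝ) * p.1 + (M 1 1 : ℝ) * p.2 + (w.2 : ℝ)))) '' P = Q

theorem UnimodEquiv.symm {P Q : Set (ℝ × ℝ)} (h : UnimodEquiv P Q) : UnimodEquiv Q P := by
  obtain ⟨M, w, hM, rfl⟩ := h
  have hd : M.det * M.det = 1 := by rcases hM with h | h <;> simp [h]
  have hdet : M.det = M 0 0 * M 1 1 - M 0 1 * M 1 0 := Matrix.det_fin_two M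
  generalize M.det = d at hM hd hdet
  have hR : (d : ℝ) * ((M 0 0 : ℝ) * M 1 1 - M 0 1 * M 1 0) = 1 := by
    rw [hdet] at hd ⊢
    exact_mod_cast hd
  refine ⟨!![d * M 1 1, -(d * M 0 1); -(d * M 1 0), d * M 0 0],
    (-(d * M 1 1 * w.1) + d * M 0 1 * w.2, d * M 1 0 * w.1 - d * M 0 0 * w.2), ?_, ?_⟩
  · have : (!![d * M 1 1, -(d * M 0 1); -(d * M 1 0), d * M 0 0]).det = d := by
      rw [Matrix.det_fin_two_of]
      linear_combination d * hd - d ^ 2 * hdet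
    rwa [this]
  · rw [Set.image_image]
    convert Set.image_id P using 2 with p
    ext
    · simp
      linear_combination p.1 * hR
    · simp
      linear_combination p.2 * hR

theorem UnimodEquiv.trans {P Q R : Set (ℝ × ℝ)} (h : UnimodEquiv P Q) (h' : UnimodEquiv Q R) :
    UnimodEquiv P R := by
  obtain ⟨M, w, hM, rfl⟩ := h
  obtain ⟨N, v, hN, rfl⟩ := h'
  refine ⟨N * M, (N 0 0 * w.1 + N 0 1 * w.2 + v.1, N 1 0 * w.1 + N 1 1 * w.2 + v.2), ?_, ?_⟩
  · rw [Matrix.det_mul]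
    rcases hM with h | h <;> rcases hN with h' | h' <;> simp [h, h']
  · rw [Set.image_image]
    congr 1
    ext p <;> simp [Matrix.mul_apply, Fin.sum_univ_two] <;> ring

theorem UnimodEquiv.refl (P : Set (ℝ × ℝ)) : UnimodEquiv P P :=
  ⟨1, 0, by simp, by simp⟩

/-- The image of a convex hull under the affine map `(x, y) ↦ (p x + q y + u, r x + s y + v)`. -/
theorem image_convexHull_affine_prod (p q r s u v : ℝ) (S : Set (ℝ × ℝ)) :
    (fun x : ℝ × ℝ => (p * x.1 + q * x.2 + u, r * x.1 + s * x.2 + v)) '' convexHull ℝ S =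
      convexHull ℝ ((fun x : ℝ × ℝ => (p * x.1 + q * x.2 + u, r * x.1 + s * x.2 + v)) '' S) := by
  let f : ℝ × ℝ →ₗ[ℝ] ℝ × ℝ :=
    (p • LinearMap.fst ℝ ℝ ℝ + q • LinearMap.snd ℝ ℝ ℝ).prod
      (r • LinearMap.fst ℝ ℝ ℝ + s • LinearMap.snd ℝ ℝ ℝ)
  exact (f.toAffineMap + AffineMap.const ℝ (ℝ × ℝ) (u, v)).image_convexHull S

/-- Reflecting a parallelogram and shearing it replaces `a` by `n - a`. -/
theorem unimodEquiv_Pan_sub {a n : ℕ} (h : a ≤ n) : UnimodEquiv (Pan a n) (Pan (n - a) n) := by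
  refine ⟨!![-1, 1; 0, 1], (1, 0), by simp, ?_⟩
  rw [Pan, Pan, image_convexHull_affine_prod]
  congr 1
  simp only [Set.image_insert_eq, Set.image_singleton]
  push_cast [h]
  ext x
  simp
  ring_nf
  tauto

/-- Interchanging the two edge directions replaces `a` by its inverse modulo `n`. -/
theorem unimodEquiv_Pan_of_mul_modEq_one {a b n : ℕ} (h : a * b ≡ 1 [MOD n]) :
    UnimodEquiv (Pan a n) (Pan b n) := by
  obtain ⟨c, hc⟩ : (n : ℤ) ∣ 1 - a * b := by simpa using (Nat.modEq_iff_dvd.mp h)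
  have hR : (c : ℝ) * n = 1 - a * b := by
    rw [mul_comm]
    exact_mod_cast hc.symm
  refine ⟨!![(b : ℤ), c; n, -a], (0, 0), Or.inr ?_, ?_⟩
  · rw [Matrix.det_fin_two_of]
    linear_combination hc
  · rw [Pan, Pan, image_convexHull_affine_prod]
    congr 1
    simp only [Set.image_insert_eq, Set.image_singleton]
    ext x
    simp [hR]
    ring_nf
    tauto

/-- The four clean parallelograms `P_{a,n}`, `P_{n-a,n}`, `P_{a⁻¹,n}`, `P_{n-a⁻¹,n}` are
pairwise unimodularly equivalent. -/
theorem stmt_3 (a b n : ℕ) (ha : 0 < a) (han : a < n) (hn : 1 < n)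
    (hco : Nat.Coprime a n) (hb : 0 < b) (hbn : b < n)
    (hinv : a * b ≡ 1 [MOD n]) :
    ∀ P ∈ ({Pan a n, Pan (n - a) n, Pan b n, Pan (n - b) n} : Set (Set (ℝ × ℝ))),
      ∀ Q ∈ ({Pan a n, Pan (n - a) n, Pan b n, Pan (n - b) n} : Set (Set (ℝ × ℝ))),
        UnimodEquiv P Q := by
  have h₁ := unimodEquiv_Pan_sub han.le
  have h₂ := unimodEquiv_Pan_of_mul_modEq_one hinv
  have h₃ := h₂.trans (unimodEquiv_Pan_sub hbn.le)
  have key : ∀ P ∈ ({Pan a n, Pan (n - a) n, Pan b n, Pan (n - b) n} : Set (Set (ℝ × ℝ))),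
      UnimodEquiv (Pan a n) P := by
    rintro P (rfl | rfl | rfl | rfl)
    exacts [UnimodEquiv.refl _, h₁, h₂, h₃]
  intro P hP Q hQ
  exact (key P hP).symm.trans (key Q hQ)
end

section
/- Let a, n be positive integers with a < n and gcd(a,n) = 1. The set of lattice points in the topological interior of P_{a,n} is exactly { ⟨k(n−a)/n⟩·(1,0) + (k/n)·(a,n) : k = 1, 2, …, n−1 }, where ⟨x⟩ denotes the fractional part of x; equivalently, it is the set of points ( ⟨k(n−a)/n⟩ + ka/n , k ) for k = 1, …, n−1. -/
/-- The coordinates of a point of the plane with respect to the basis `(1,0), (a,n)`. -/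
noncomputable def panCoord (a n : ℕ) (hn : (n : ℝ) ≠ 0) : (ℝ × ℝ) ≃ₗ[ℝ] (ℝ × ℝ) where
  toFun p := (p.1 - p.2 * a / n, p.2 / n)
  invFun q := (q.1 + q.2 * a, q.2 * n)
  map_add' p q := by ext <;> simp <;> ring
  map_smul' c p := by ext <;> simp <;> ring
  left_inv p := by
    ext <;> simp <;> field_simp
    ring
  right_inv q := by
    ext <;> simp <;> field_simp
    ring

theorem panCoord_apply (a n : ℕ) (hn : (n : ℝ) ≠ 0) (p : ℝ × ℝ) :
    panCoord a n hn p = (p.1 - p.2 * a / n, p.2 / n) := rfl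

theorem Pan_eq_preimage (a n : ℕ) (hn : (n : ℝ) ≠ 0) :
    Pan a n = panCoord a n hn ⁻¹' (Set.Icc 0 1 ×ˢ Set.Icc 0 1) := by
  apply Set.Subset.antisymm
  · refine convexHull_min ?_ (((convex_Icc (0 : ℝ) 1).prod (convex_Icc (0 : ℝ) 1)).linear_preimage
      (panCoord a n hn).toLinearMap)
    rintro p (rfl | rfl | rfl | rfl) <;> simp [panCoord_apply, hn]
  · intro p hp
    obtain ⟨⟨hu, hu'⟩, hv, hv'⟩ := hp
    set u := (panCoord a n hn p).1 with hu_def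
    set v := (panCoord a n hn p).2 with hv_def
    have hp : p = (1 - v) • ((1 - u) • ((0, 0) : ℝ × ℝ) + u • ((1, 0) : ℝ × ℝ)) +
        v • ((1 - u) • ((a : ℝ), (n : ℝ)) + u • ((a : ℝ) + 1, (n : ℝ))) := by
      simp only [hu_def, hv_def, panCoord_apply]
      ext <;> simp <;> field_simp <;> ring
    rw [hp]
    have hc := convex_convexHull ℝ
      ({(0, 0), (1, 0), ((a : ℝ), (n : ℝ)), ((a : ℝ) + 1, (n : ℝ))} : Set (ℝ × ℝ))
    have hs := subset_convexHull ℝ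
      ({(0, 0), (1, 0), ((a : ℝ), (n : ℝ)), ((a : ℝ) + 1, (n : ℝ))} : Set (ℝ × ℝ))
    exact hc (hc (hs (by simp)) (hs (by simp)) (by linarith) hu (by ring))
      (hc (hs (by simp)) (hs (by simp)) (by linarith) hu (by ring)) (by linarith) hv (by ring)

theorem mem_interior_Pan (a n : ℕ) (hn : (n : ℝ) ≠ 0) (p : ℝ × ℝ) :
    p ∈ interior (Pan a n) ↔
      (0 < p.1 - p.2 * a / n ∧ p.1 - p.2 * a / n < 1) ∧ 0 < p.2 / n ∧ p.2 / n < 1 := by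
  have h := (panCoord a n hn).toContinuousLinearEquiv.toHomeomorph.preimage_interior
    (Set.Icc (0 : ℝ) 1 ×ˢ Set.Icc (0 : ℝ) 1)
  rw [interior_prod_eq, interior_Icc] at h
  rw [Pan_eq_preimage a n hn]
  exact (Set.ext_iff.1 h p).symm

/-- The lattice points in the interior of `P_{a,n}` are exactly the points
`⟨k(n-a)/n⟩ • (1,0) + (k/n) • (a,n) = (⟨k(n-a)/n⟩ + ka/n, k)` for `k = 1, …, n-1`,
where `⟨x⟩` denotes the fractional part. -/
theorem stmt_4 (a n : ℕ) (ha : 0 < a) (han : a < n) (hco : Nat.Coprime a n) :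
    interior (Pan a n) ∩ latt =
      (fun k : ℤ =>
          ((Int.fract ((k : ℝ) * ((n : ℝ) - (a : ℝ)) / (n : ℝ)) + (k : ℝ) * (a : ℝ) / (n : ℝ),
            (k : ℝ)) : ℝ × ℝ)) '' (Set.Icc (1 : ℤ) ((n : ℤ) - 1)) := by
  have hn0 : (0 : ℝ) < n := by exact_mod_cast ha.trans han
  have hn : (n : ℝ) ≠ 0 := hn0.ne'
  ext p
  constructor
  · rintro ⟨hp, ⟨x, k⟩, rfl⟩
    rw [mem_interior_Pan a n hn, div_pos_iff_of_pos_right hn0, div_lt_one hn0] at hp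
    dsimp only at hp
    obtain ⟨⟨hx, hx'⟩, hk, hk'⟩ := hp
    have hk0 : (0 : ℤ) < k := by exact_mod_cast hk
    have hkn : k < (n : ℤ) := by exact_mod_cast hk'
    refine ⟨k, ⟨by lia, by lia⟩, ?_⟩
    have hf : Int.fract ((k : ℝ) * ((n : ℝ) - a) / n) = x - k * a / n := by
      rw [Int.fract_eq_iff]
      refine ⟨hx.le, hx', k - x, ?_⟩
      push_cast
      field_simp
      ring
    simp [hf]
  · rintro ⟨k, ⟨hk, hkn⟩, rfl⟩
    have hk0 : (0 : ℝ) < k := by exact_mod_cast (by lia : (0 : ℤ) < k)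
    have hk' : (k : ℝ) < n := by exact_mod_cast (by lia : k < (n : ℤ))
    refine ⟨?_, (k - ⌊(k : ℝ) * ((n : ℝ) - a) / n⌋, k), ?_⟩
    · rw [mem_interior_Pan a n hn, div_pos_iff_of_pos_right hn0, div_lt_one hn0]
      simp only [add_sub_cancel_right]
      refine ⟨⟨(Int.fract_nonneg _).lt_of_ne' fun h => ?_, Int.fract_lt_one _⟩, hk0, hk'⟩
      obtain ⟨z, hz⟩ := Int.fract_eq_zero_iff.1 h
      rw [eq_div_iff hn] at hz
      have hz' : z * (n : ℤ) = k * (n - a) := by exact_mod_cast hz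
      have hdvd : (n : ℤ) ∣ k * a := ⟨k - z, by linear_combination hz'⟩
      have hcop : IsCoprime (n : ℤ) a := Nat.isCoprime_iff_coprime.2 hco.symm
      have := Int.le_of_dvd (by lia) (hcop.dvd_of_dvd_mul_right hdvd)
      lia
    · ext
      · simp only [Int.fract]
        push_cast
        field_simp
        ring
      · rfl
end

section
/- Let a, n be positive integers with a < n and gcd(a,n) = 1. Then the interior hull of P_{a,n} equals the convex hull of the finite set { L(S_k), H(S_k) : k = 1, …, a }, i.e. P_{a,n}^{(1)} = conv({L(S_k), H(S_k) : 1 ≤ k ≤ a}). -/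
/-- `S_k`: the lattice points in the interior of `P_{a,n}` with `x`-coordinate `k`. -/
noncomputable def Sk (a n k : ℕ) : Set (ℝ × ℝ) :=
  {p | p ∈ interior (Pan a n) ∧ p ∈ latt ∧ p.1 = (k : ℝ)}

/-- The parallelogram `P_{a,n}` lies in its bounding box. -/
theorem Pan_subset_box (a n : ℕ) :
    Pan a n ⊆ Set.Icc (0 : ℝ) (a + 1) ×ˢ Set.Icc (0 : ℝ) n := by
  refine convexHull_min ?_ ((convex_Icc _ _).prod (convex_Icc _ _))
  have h₁ : (0 : ℝ) ≤ a := Nat.cast_nonneg a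
  have h₂ : (0 : ℝ) ≤ n := Nat.cast_nonneg n
  rintro p (rfl | rfl | rfl | rfl) <;>
    simp only [Set.mem_prod, Set.mem_Icc] <;> refine ⟨⟨?_, ?_⟩, ?_, ?_⟩ <;> linarith

theorem interior_Pan_subset_box (a n : ℕ) :
    interior (Pan a n) ⊆ Set.Ioo (0 : ℝ) (a + 1) ×ˢ Set.Ioo (0 : ℝ) n := by
  have h := interior_mono (Pan_subset_box a n)
  rwa [interior_prod_eq, interior_Icc, interior_Icc] at h

/-- The interior hull of `P_{a,n}` is the convex hull of the lowest and highest points of the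
columns `S_1, …, S_a`. -/
theorem stmt_6 (a n : ℕ) (ha : 0 < a) (han : a < n) (hco : Nat.Coprime a n) :
    convexHull ℝ (interior (Pan a n) ∩ latt) =
      convexHull ℝ {p : ℝ × ℝ | ∃ k : ℕ, 1 ≤ k ∧ k ≤ a ∧ p ∈ Sk a n k ∧
        ((∀ q ∈ Sk a n k, p.2 ≤ q.2) ∨ (∀ q ∈ Sk a n k, q.2 ≤ p.2))} := by
  refine Set.Subset.antisymm (convexHull_min ?_ (convex_convexHull ℝ _)) (convexHull_mono ?_)
  · rintro _ ⟨hp, ⟨x, y⟩, rfl⟩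
    obtain ⟨⟨hx₀, hx₁⟩, -⟩ := interior_Pan_subset_box a n hp
    dsimp only at hp hx₀ hx₁ ⊢
    have hx₀' : 0 < x := by exact_mod_cast hx₀
    have hx₁' : x < a + 1 := by exact_mod_cast hx₁
    lift x to ℕ using hx₀'.le
    rw [Int.cast_natCast] at hp ⊢
    have hmem : ∀ z : ℤ, ((x : ℝ), (z : ℝ)) ∈ interior (Pan a n) → 0 < z ∧ z < n := by
      intro z hz
      obtain ⟨-, h₀, h₁⟩ := interior_Pan_subset_box a n hz
      dsimp only at h₀ h₁
      exact ⟨by exact_mod_cast h₀, by exact_mod_cast h₁⟩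
    have hSk : ∀ z : ℤ, ((x : ℝ), (z : ℝ)) ∈ interior (Pan a n) →
        ((x : ℝ), (z : ℝ)) ∈ Sk a n x := fun z hz => ⟨hz, ⟨(x, z), by simp⟩, rfl⟩
    obtain ⟨l, hl, hl_min⟩ := Int.exists_least_of_bdd
      (P := fun z : ℤ => ((x : ℝ), (z : ℝ)) ∈ interior (Pan a n))
      ⟨0, fun z hz => (hmem z hz).1.le⟩ ⟨y, hp⟩
    obtain ⟨u, hu, hu_max⟩ := Int.exists_greatest_of_bdd
      (P := fun z : ℤ => ((x : ℝ), (z : ℝ)) ∈ interior (Pan a n))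
      ⟨n, fun z hz => (hmem z hz).2.le⟩ ⟨y, hp⟩
    refine segment_subset_convexHull
      (s := {p : ℝ × ℝ | ∃ k : ℕ, 1 ≤ k ∧ k ≤ a ∧ p ∈ Sk a n k ∧
        ((∀ q ∈ Sk a n k, p.2 ≤ q.2) ∨ (∀ q ∈ Sk a n k, q.2 ≤ p.2))})
      (x := ((x : ℝ), (l : ℝ))) (y := ((x : ℝ), (u : ℝ)))
      ⟨x, by omega, by omega, hSk l hl, Or.inl ?_⟩ ⟨x, by omega, by omega, hSk u hu, Or.inr ?_⟩ ?_
    · rintro _ ⟨hq, ⟨⟨v, w⟩, rfl⟩, hv⟩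
      dsimp only at hq hv ⊢
      rw [hv] at hq
      exact_mod_cast hl_min w hq
    · rintro _ ⟨hq, ⟨⟨v, w⟩, rfl⟩, hv⟩
      dsimp only at hq hv ⊢
      rw [hv] at hq
      exact_mod_cast hu_max w hq
    · have hly : (l : ℝ) ≤ y := by exact_mod_cast hl_min y hp
      have hyu : (y : ℝ) ≤ u := by exact_mod_cast hu_max y hp
      rw [← Prod.image_mk_segment_right, segment_eq_Icc (hly.trans hyu)]
      exact ⟨y, ⟨hly, hyu⟩, rfl⟩
  · rintro p ⟨k, -, -, ⟨hp, hlatt, -⟩, -⟩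
    exact ⟨hp, hlatt⟩
end

section
/- Let a, n be positive integers with a < n and gcd(a,n) = 1, and let k, l be positive integers with 1 ≤ k, l ≤ a and k + l = a + 1. Then L(S_k) + H(S_l) = (a+1, n); equivalently, with S(x,y) = (a+1−x, n−y), one has H(S_l) = S(L(S_k)) and L(S_k) = S(H(S_l)). -/
/-- `p = L(S_k)`: the point of `S_k` with smallest `y`-coordinate. -/
noncomputable def IsLowest (a n k : ℕ) (p : ℝ × ℝ) : Prop :=
  p ∈ Sk a n k ∧ ∀ q ∈ Sk a n k, p.2 ≤ q.2

/-- `p = H(S_k)`: the point of `S_k` with largest `y`-coordinate. -/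
noncomputable def IsHighest (a n k : ℕ) (p : ℝ × ℝ) : Prop :=
  p ∈ Sk a n k ∧ ∀ q ∈ Sk a n k, q.2 ≤ p.2

open scoped Pointwise in
/-- The central symmetry `z ↦ (a+1, n) - z` preserves `P_{a,n}`. -/
theorem vadd_neg_Pan (a n : ℕ) :
    (((a : ℝ) + 1, (n : ℝ)) : ℝ × ℝ) +ᵥ (-Pan a n) = Pan a n := by
  unfold Pan
  rw [← convexHull_neg, ← convexHull_vadd]
  congr 1
  ext ⟨x, y⟩
  simp only [Set.mem_vadd_set_iff_neg_vadd_mem, Set.mem_neg, vadd_eq_add, Set.mem_insert_iff,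
    Set.mem_singleton_iff, Prod.ext_iff, Prod.fst_add, Prod.snd_add, Prod.fst_neg, Prod.snd_neg]
  constructor
  · rintro (⟨h1, h2⟩ | ⟨h1, h2⟩ | ⟨h1, h2⟩ | ⟨h1, h2⟩)
    · exact .inr (.inr (.inr ⟨by linarith, by linarith⟩))
    · exact .inr (.inr (.inl ⟨by linarith, by linarith⟩))
    · exact .inr (.inl ⟨by linarith, by linarith⟩)
    · exact .inl ⟨by linarith, by linarith⟩
  · rintro (⟨h1, h2⟩ | ⟨h1, h2⟩ | ⟨h1, h2⟩ | ⟨h1, h2⟩)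
    · exact .inr (.inr (.inr ⟨by linarith, by linarith⟩))
    · exact .inr (.inr (.inl ⟨by linarith, by linarith⟩))
    · exact .inr (.inl ⟨by linarith, by linarith⟩)
    · exact .inl ⟨by linarith, by linarith⟩

open scoped Pointwise in
theorem sub_mem_interior_Pan {a n : ℕ} {p : ℝ × ℝ} (hp : p ∈ interior (Pan a n)) :
    (((a : ℝ) + 1, (n : ℝ)) : ℝ × ℝ) - p ∈ interior (Pan a n) := by
  have hneg : interior (-Pan a n) = -interior (Pan a n) :=
    ((Homeomorph.neg (ℝ × ℝ)).preimage_interior (Pan a n)).symm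
  rw [← vadd_neg_Pan, interior_vadd, hneg, Set.mem_vadd_set_iff_neg_vadd_mem]
  simpa using hp

theorem sub_mem_Sk {a n k l : ℕ} (hkl : k + l = a + 1) {p : ℝ × ℝ} (hp : p ∈ Sk a n k) :
    (((a : ℝ) + 1, (n : ℝ)) : ℝ × ℝ) - p ∈ Sk a n l := by
  obtain ⟨hint, ⟨z, rfl⟩, hk⟩ := hp
  refine ⟨sub_mem_interior_Pan hint, ⟨((a : ℤ) + 1 - z.1, (n : ℤ) - z.2), ?_⟩, ?_⟩
  · simp
  · have h : (k : ℝ) + l = a + 1 := mod_cast hkl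
    simp only [Prod.fst_sub] at hk ⊢
    linarith

/-- If `k + l = a + 1` then `L(S_k) + H(S_l) = (a+1, n)`; equivalently, with
`S(x,y) = (a+1-x, n-y)` one has `H(S_l) = S(L(S_k))` and `L(S_k) = S(H(S_l))`. -/
theorem stmt_8 (a n : ℕ) (ha : 0 < a) (han : a < n) (hco : Nat.Coprime a n)
    (k l : ℕ) (hk1 : 1 ≤ k) (hka : k ≤ a) (hl1 : 1 ≤ l) (hla : l ≤ a)
    (hkl : k + l = a + 1) (p q : ℝ × ℝ)
    (hp : IsLowest a n k p) (hq : IsHighest a n l q) :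
    p + q = (((a : ℝ) + 1, (n : ℝ)) : ℝ × ℝ) ∧
    q = (((a : ℝ) + 1 - p.1, (n : ℝ) - p.2) : ℝ × ℝ) ∧
    p = (((a : ℝ) + 1 - q.1, (n : ℝ) - q.2) : ℝ × ℝ) := by
  have h1 := hp.2 _ (sub_mem_Sk ((Nat.add_comm l k).trans hkl) hq.1)
  have h2 := hq.2 _ (sub_mem_Sk hkl hp.1)
  have h3 := hp.1.2.2
  have h4 := hq.1.2.2
  have h5 : (k : ℝ) + l = a + 1 := mod_cast hkl
  simp only [Prod.snd_sub] at h1 h2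
  simp only [Prod.ext_iff, Prod.fst_add, Prod.snd_add]
  refine ⟨⟨?_, ?_⟩, ⟨?_, ?_⟩, ?_, ?_⟩ <;> linarith
end

section
/- Let a < n be coprime positive integers with n > 1, m ≥ 1, and continued fraction data as below. Then A_i < n/2 for all 0 ≤ i ≤ m−1. Moreover, for every even index i with 0 ≤ i < m, the convergent point (B_i, A_i) satisfies (n/a)(B_i − 1/2) < A_i < (n/a)B_i (so it lies strictly inside the subparallelogram P₁ of P_{a,n}); and for every odd index i with 0 ≤ i < m, the point (B_i + 1, A_i) satisfies (n/a)B_i < A_i < (n/a)(B_i + 1/2) (so it lies strictly inside P₂). Consequently, with S(x,y) = (a+1−x, n−y), the images under S of these points lie strictly inside P₃ = S(P₁) and P₄ = S(P₂) respectively. -/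
theorem convergents_cross (m : ℕ) (q : ℕ → ℕ) (v : ℕ → ℤ × ℤ)
    (hv0 : v 0 = (1, 0)) (hv1 : v 1 = (0, 1))
    (hrec : ∀ i ≤ m, v (i + 2) = v i + (q i : ℤ) • v (i + 1)) :
    ∀ j ≤ m + 1, (v (j + 1)).2 * (v j).1 - (v (j + 1)).1 * (v j).2 = (-1) ^ j := by
  intro j
  induction j with
  | zero => simp [hv0, hv1]
  | succ j ih =>
    intro hj
    have h := ih (by omega)
    rw [hrec j (by omega), pow_succ, ← h]
    simp only [Prod.fst_add, Prod.snd_add, Prod.smul_fst, Prod.smul_snd, smul_eq_mul]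
    ring

theorem convergents_snd_pos (m : ℕ) (q : ℕ → ℕ) (v : ℕ → ℤ × ℤ)
    (hv0 : v 0 = (1, 0)) (hv1 : v 1 = (0, 1))
    (hrec : ∀ i ≤ m, v (i + 2) = v i + (q i : ℤ) • v (i + 1))
    (hq : ∀ i ≤ m, 1 ≤ q i) :
    ∀ j ≤ m + 1, 0 ≤ (v j).2 ∧ 0 < (v (j + 1)).2 ∧ (v j).2 ≤ (v (j + 1)).2 := by
  intro j
  induction j with
  | zero => simp [hv0, hv1]
  | succ j ih =>
    intro hj
    obtain ⟨h0, h1, -⟩ := ih (by omega)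
    have hqj : (1 : ℤ) ≤ q j := by exact_mod_cast hq j (by omega)
    rw [hrec j (by omega)]
    simp only [Prod.snd_add, Prod.smul_snd, smul_eq_mul]
    refine ⟨h1.le, ?_, ?_⟩ <;> nlinarith

theorem convergents_two_mul_snd_lt (m : ℕ) (q : ℕ → ℕ) (v : ℕ → ℤ × ℤ)
    (hv0 : v 0 = (1, 0)) (hv1 : v 1 = (0, 1))
    (hrec : ∀ i ≤ m, v (i + 2) = v i + (q i : ℤ) • v (i + 1))
    (hq : ∀ i ≤ m, 1 ≤ q i) (hqm : 2 ≤ q m) (i : ℕ) (hi : i < m) :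
    2 * (v (i + 2)).2 < (v (m + 2)).2 := by
  have hA := convergents_snd_pos m q v hv0 hv1 hrec hq
  have hmono : ∀ k, i + 2 + k ≤ m + 1 → (v (i + 2)).2 ≤ (v (i + 2 + k)).2 := by
    intro k
    induction k with
    | zero => simp
    | succ k ih =>
      intro hk
      exact (ih (by omega)).trans (hA (i + 2 + k) (by omega)).2.2
  have h1 := hmono (m - 1 - i) (by omega)
  rw [show i + 2 + (m - 1 - i) = m + 1 by omega] at h1
  have h2 := (hA (m - 1) (by omega)).2.1
  rw [show m - 1 + 1 = m by omega] at h2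
  have h3 := (hA m (by omega)).2.1
  have hqm' : (2 : ℤ) ≤ q m := by exact_mod_cast hqm
  rw [hrec m le_rfl]
  simp only [Prod.snd_add, Prod.smul_snd, smul_eq_mul]
  nlinarith

/-- The signed remainders `(-1) ^ j * (n * Bⱼ - a * Aⱼ)` of the Euclidean algorithm are positive
and, from the first one on, smaller than `n / 2`. -/
theorem convergents_remainder_bounds (a n m : ℕ) (q : ℕ → ℕ) (v : ℕ → ℤ × ℤ)
    (hv0 : v 0 = (1, 0)) (hv1 : v 1 = (0, 1))
    (hrec : ∀ i ≤ m, v (i + 2) = v i + (q i : ℤ) • v (i + 1))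
    (hq : ∀ i ≤ m, 1 ≤ q i) (hqm : 2 ≤ q m)
    (hvm : v (m + 2) = ((a : ℤ), (n : ℤ))) (i : ℕ) (hi : i < m) :
    0 < (-1) ^ i * ((n : ℤ) * (v (i + 2)).1 - a * (v (i + 2)).2) ∧
      2 * ((-1) ^ i * ((n : ℤ) * (v (i + 2)).1 - a * (v (i + 2)).2)) < n := by
  obtain ⟨e, he⟩ : ∃ e : ℕ → ℤ, ∀ j, e j = (-1) ^ j * ((n : ℤ) * (v j).1 - a * (v j).2) :=
    ⟨_, fun _ => rfl⟩
  have erec : ∀ j ≤ m, e j = e (j + 2) + q j * e (j + 1) := by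
    intro j hj
    rw [he, he, he, hrec j hj]
    simp only [Prod.fst_add, Prod.snd_add, Prod.smul_fst, Prod.smul_snd, smul_eq_mul]
    ring
  have elast : e (m + 2) = 0 := by
    rw [he, hvm]
    ring
  have epen : e (m + 1) = 1 := by
    have h := convergents_cross m q v hv0 hv1 hrec (m + 1) le_rfl
    rw [show m + 1 + 1 = m + 2 from rfl, hvm] at h
    rw [he, h, ← mul_pow]
    norm_num
  have edec : ∀ k ≤ m, 0 < e (m - k + 1) ∧ e (m - k + 1) < e (m - k) := by
    intro k
    induction k with
    | zero =>
      intro _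
      have hqm' : (2 : ℤ) ≤ q m := by exact_mod_cast hqm
      have h := erec m le_rfl
      rw [elast, epen] at h
      simp only [Nat.sub_zero, epen]
      omega
    | succ k ih =>
      intro hk
      obtain ⟨h1, h2⟩ := ih (by omega)
      have h := erec (m - (k + 1)) (by omega)
      have hqk : (1 : ℤ) ≤ q (m - (k + 1)) := by exact_mod_cast hq _ (by omega)
      rw [show m - (k + 1) + 2 = m - k + 1 by omega,
        show m - (k + 1) + 1 = m - k by omega] at h
      rw [show m - (k + 1) + 1 = m - k by omega]
      constructor <;> nlinarith
  have edec' : ∀ j ≤ m, 0 < e (j + 1) ∧ e (j + 1) < e j := by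
    intro j hj
    have h := edec (m - j) (by omega)
    rwa [show m - (m - j) = j by omega] at h
  have ehalf : ∀ j < m, 2 * e (j + 2) < n := by
    intro j
    induction j with
    | zero =>
      intro hm
      have h0 := erec 0 (by omega)
      have hn : e 0 = n := by simp [he, hv0]
      have h1 := edec' 1 (by omega)
      have h2 := edec' 0 (by omega)
      have hq0 : (1 : ℤ) ≤ q 0 := by exact_mod_cast hq 0 (by omega)
      simp only [zero_add, Nat.reduceAdd] at *
      nlinarith
    | succ j ih =>
      intro hj
      have h1 := (edec' (j + 2) (by omega)).2
      have h2 := ih (by omega)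
      rw [show j + 1 + 2 = j + 2 + 1 from rfl]
      linarith
  have hsign : e (i + 2) = (-1) ^ i * ((n : ℤ) * (v (i + 2)).1 - a * (v (i + 2)).2) := by
    rw [he]
    ring
  rw [← hsign]
  exact ⟨(edec' (i + 1) (by omega)).1, ehalf i hi⟩

/-- For the continued fraction convergent points `vᵢ = (Bᵢ, Aᵢ)` of `n/a` (indices shifted
by `2`: `v (i+2) = (Bᵢ, Aᵢ)`), all `Aᵢ < n/2` for `0 ≤ i ≤ m-1`; for even `i` the point
`(Bᵢ, Aᵢ)` lies strictly inside `P₁` (between the lines `y = (n/a)(x - 1/2)` and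
`y = (n/a)x`, below `y = n/2`); for odd `i` the point `(Bᵢ + 1, Aᵢ)` lies strictly inside
`P₂`; and the images of these points under `S(x,y) = (a+1-x, n-y)` lie strictly inside
`P₃ = S(P₁)` and `P₄ = S(P₂)` respectively. -/
theorem stmt_12 (a n : ℕ) (ha : 0 < a) (han : a < n) (hn : 1 < n)
    (hco : Nat.Coprime a n)
    (m : ℕ) (hm : 1 ≤ m) (q : ℕ → ℕ) (v : ℕ → ℤ × ℤ)
    (hv0 : v 0 = (1, 0)) (hv1 : v 1 = (0, 1))
    (hrec : ∀ i ≤ m, v (i + 2) = v i + (q i : ℤ) • v (i + 1))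
    (hq : ∀ i ≤ m, 1 ≤ q i) (hqm : 2 ≤ q m)
    (hvm : v (m + 2) = ((a : ℤ), (n : ℤ))) :
    ∀ i < m,
      (((v (i + 2)).2 : ℝ) < (n : ℝ) / 2) ∧
      (Even i →
        ((n : ℝ) / (a : ℝ)) * (((v (i + 2)).1 : ℝ) - 1 / 2) < ((v (i + 2)).2 : ℝ) ∧
        ((v (i + 2)).2 : ℝ) < ((n : ℝ) / (a : ℝ)) * ((v (i + 2)).1 : ℝ) ∧
        (n : ℝ) / 2 < (n : ℝ) - ((v (i + 2)).2 : ℝ) ∧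
        ((n : ℝ) / (a : ℝ)) * ((((a : ℝ) + 1 - ((v (i + 2)).1 : ℝ))) - 1) <
          (n : ℝ) - ((v (i + 2)).2 : ℝ) ∧
        (n : ℝ) - ((v (i + 2)).2 : ℝ) <
          ((n : ℝ) / (a : ℝ)) * (((a : ℝ) + 1 - ((v (i + 2)).1 : ℝ)) - 1 / 2)) ∧
      (Odd i →
        ((n : ℝ) / (a : ℝ)) * ((v (i + 2)).1 : ℝ) < ((v (i + 2)).2 : ℝ) ∧
        ((v (i + 2)).2 : ℝ) < ((n : ℝ) / (a : ℝ)) * (((v (i + 2)).1 : ℝ) + 1 / 2) ∧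
        (n : ℝ) / 2 < (n : ℝ) - ((v (i + 2)).2 : ℝ) ∧
        ((n : ℝ) / (a : ℝ)) * (((a : ℝ) - ((v (i + 2)).1 : ℝ)) - 1 / 2) <
          (n : ℝ) - ((v (i + 2)).2 : ℝ) ∧
        (n : ℝ) - ((v (i + 2)).2 : ℝ) <
          ((n : ℝ) / (a : ℝ)) * ((a : ℝ) - ((v (i + 2)).1 : ℝ))) := by
  intro i hi
  have hA := convergents_two_mul_snd_lt m q v hv0 hv1 hrec hq hqm i hi
  obtain ⟨hpos, hlt⟩ := convergents_remainder_bounds a n m q v hv0 hv1 hrec hq hqm hvm i hi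
  rw [hvm] at hA
  generalize (v (i + 2)).1 = B at *
  generalize (v (i + 2)).2 = A at *
  have hA' : 2 * (A : ℝ) < n := by exact_mod_cast hA
  have ha' : (0 : ℝ) < a := by exact_mod_cast ha
  have hc : (n : ℝ) / a * a = n := div_mul_cancel₀ _ ha'.ne'
  refine ⟨by linarith, fun he => ?_, fun ho => ?_⟩
  · rw [he.neg_one_pow, one_mul] at hpos hlt
    have h1 : 0 < (n : ℝ) * B - a * A := by exact_mod_cast hpos
    have h2 : 2 * ((n : ℝ) * B - a * A) < n := by exact_mod_cast hlt
    have h3 : (n : ℝ) / a * (B - 1 / 2) < A := by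
      rw [div_mul_eq_mul_div, div_lt_iff₀ ha']
      linarith
    have h4 : (A : ℝ) < n / a * B := by
      rw [div_mul_eq_mul_div, lt_div_iff₀ ha']
      linarith
    refine ⟨h3, h4, ?_, ?_, ?_⟩ <;> linarith
  · rw [ho.neg_one_pow] at hpos hlt
    have h1 : 0 < -1 * ((n : ℝ) * B - a * A) := by exact_mod_cast hpos
    have h2 : 2 * (-1 * ((n : ℝ) * B - a * A)) < n := by exact_mod_cast hlt
    have h3 : (n : ℝ) / a * B < A := by
      rw [div_mul_eq_mul_div, div_lt_iff₀ ha']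
      linarith
    have h4 : (A : ℝ) < n / a * (B + 1 / 2) := by
      rw [div_mul_eq_mul_div, lt_div_iff₀ ha']
      linarith
    refine ⟨h3, h4, ?_, ?_, ?_⟩ <;> linarith
end

section
/- Let a < n be coprime positive integers with continued fraction data as below. For 0 ≤ i ≤ m, let T_i be the closed triangle with vertices (0,0), v_{i−2}, and v_i. Then: (1) the closed segment joining v_{i−2} to v_i contains exactly q_i + 1 lattice points; (2) the topological interior of T_i contains no lattice points; (3) every lattice point of T_i other than its three vertices lies on the segment joining v_{i−2} to v_i. -/
open Filter Topology in
theorem exists_add_sub_mem_of_mem_interior {s : Set (ℝ × ℝ)} {p : ℝ × ℝ}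
    (hp : p ∈ interior s) (d : ℝ × ℝ) : ∃ ε : ℝ, 0 < ε ∧ p + ε • d ∈ s ∧ p - ε • d ∈ s := by
  have hs : s ∈ 𝓝 p := mem_interior_iff_mem_nhds.mp hp
  have hadd : Tendsto (fun t : ℝ => p + t • d) (𝓝[>] 0) (𝓝 p) := by
    have : Continuous fun t : ℝ => p + t • d := by fun_prop
    simpa using (this.tendsto 0).mono_left nhdsWithin_le_nhds
  have hsub : Tendsto (fun t : ℝ => p - t • d) (𝓝[>] 0) (𝓝 p) := by
    have : Continuous fun t : ℝ => p - t • d := by fun_prop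
    simpa using (this.tendsto 0).mono_left nhdsWithin_le_nhds
  obtain ⟨ε, ⟨h₁, h₂⟩, h₃⟩ :=
    (((hadd.eventually_mem hs).and (hsub.eventually_mem hs)).and self_mem_nhdsWithin).exists
  exact ⟨ε, h₃, h₁, h₂⟩

theorem exists_of_mem_convexHull_zero_pair {x y p : ℝ × ℝ}
    (hp : p ∈ convexHull ℝ ({0, x, y} : Set (ℝ × ℝ))) :
    ∃ α β : ℝ, 0 ≤ α ∧ 0 ≤ β ∧ α + β ≤ 1 ∧ p = α • x + β • y := by
  rw [convexHull_insert (Set.insert_nonempty _ _), convexHull_pair, mem_convexJoin] at hp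
  obtain ⟨z, hz, r, ⟨a, b, ha, hb, hab, rfl⟩, ⟨s, t, hs, ht, hst, rfl⟩⟩ := hp
  rw [Set.mem_singleton_iff] at hz
  subst hz
  refine ⟨t * a, t * b, by positivity, by positivity, ?_, ?_⟩
  · rw [← mul_add, hab]; linarith
  · simp [smul_smul]

section Unimodular

variable {u w : ℤ × ℤ}

theorem exists_eq_of_mem_latt (hd : (u.1 * w.2 - u.2 * w.1) ^ 2 = 1) {p : ℝ × ℝ}
    (hp : p ∈ latt) : ∃ x y : ℤ, p = (x : ℝ) • c u + (y : ℝ) • c w := by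
  obtain ⟨z, rfl⟩ := hp
  have hd' : ((u.1 : ℝ) * w.2 - u.2 * w.1) ^ 2 = 1 := by exact_mod_cast hd
  refine ⟨(u.1 * w.2 - u.2 * w.1) * (z.1 * w.2 - z.2 * w.1),
    (u.1 * w.2 - u.2 * w.1) * (u.1 * z.2 - u.2 * z.1), ?_⟩
  ext
  · simp [c]
    linear_combination (-z.1 : ℝ) * hd'
  · simp [c]
    linear_combination (-z.2 : ℝ) * hd'

theorem coords_eq_of_combination_eq (hd : (u.1 * w.2 - u.2 * w.1) ^ 2 = 1) {x y x' y' : ℝ}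
    (h : x • c u + y • c w = x' • c u + y' • c w) : x = x' ∧ y = y' := by
  have hd' : ((u.1 : ℝ) * w.2 - u.2 * w.1) ^ 2 = 1 := by exact_mod_cast hd
  simp only [c, Prod.ext_iff, Prod.fst_add, Prod.snd_add, Prod.smul_fst, Prod.smul_snd,
    smul_eq_mul] at h
  obtain ⟨h₁, h₂⟩ := h
  constructor
  · linear_combination ((u.1 : ℝ) * w.2 - u.2 * w.1) * (w.2 * h₁ - w.1 * h₂) - (x - x') * hd'
  · linear_combination ((u.1 : ℝ) * w.2 - u.2 * w.1) * (u.1 * h₂ - u.2 * h₁) - (y - y') * hd'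

theorem c_add_zsmul (k : ℕ) : c (u + (k : ℤ) • w) = c u + (k : ℝ) • c w := by
  ext <;> simp [c]

theorem coord_mem_Icc_of_mem_convexHull (hd : (u.1 * w.2 - u.2 * w.1) ^ 2 = 1) (k : ℕ) {x y : ℝ}
    (h : x • c u + y • c w ∈ convexHull ℝ ({0, c u, c (u + (k : ℤ) • w)} : Set (ℝ × ℝ))) :
    x ∈ Set.Icc 0 1 ∧ y ∈ Set.Icc 0 (x * k) := by
  obtain ⟨α, β, hα, hβ, hαβ, h⟩ := exists_of_mem_convexHull_zero_pair h
  have h' : x • c u + y • c w = (α + β) • c u + (β * k) • c w := by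
    rw [h, c_add_zsmul]; module
  obtain ⟨rfl, rfl⟩ := coords_eq_of_combination_eq hd h'
  exact ⟨⟨by positivity, hαβ⟩, by positivity, by gcongr; linarith⟩

theorem segment_inter_latt_eq_image (hd : (u.1 * w.2 - u.2 * w.1) ^ 2 = 1) (k : ℕ) :
    segment ℝ (c u) (c (u + (k : ℤ) • w)) ∩ latt =
      (fun j : ℕ => c u + (j : ℝ) • c w) '' (Finset.range (k + 1) : Set ℕ) := by
  ext p
  constructor
  · rintro ⟨⟨α, β, hα, hβ, hαβ, h⟩, hp⟩
    obtain ⟨x, y, rfl⟩ := exists_eq_of_mem_latt hd hp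
    have h' : (x : ℝ) • c u + (y : ℝ) • c w = (1 : ℝ) • c u + (β * k) • c w := by
      rw [← h, c_add_zsmul, ← hαβ]; module
    obtain ⟨hx, hy⟩ := coords_eq_of_combination_eq hd h'
    have hy0 : 0 ≤ y := by
      have : (0 : ℝ) ≤ y := by rw [hy]; positivity
      exact_mod_cast this
    have hyk : y ≤ k := by
      have : (y : ℝ) ≤ k := by
        rw [hy]; exact mul_le_of_le_one_left (by positivity) (by linarith)
      exact_mod_cast this
    lift y to ℕ using hy0
    refine ⟨y, ?_, ?_⟩
    · simp; omega
    · simp [hx]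
  · rintro ⟨j, hj, rfl⟩
    have hjk : j ≤ k := by simpa [Nat.lt_succ_iff] using hj
    refine ⟨?_, u + (j : ℤ) • w, (c_add_zsmul j).symm⟩
    rw [c_add_zsmul, segment_eq_image']
    rcases Nat.eq_zero_or_pos k with rfl | hk
    · exact ⟨0, by simp, by simp [Nat.le_zero.mp hjk]⟩
    · have hk' : (0 : ℝ) < k := by exact_mod_cast hk
      refine ⟨j / k, ⟨by positivity, ?_⟩, ?_⟩
      · rw [div_le_one hk']; exact_mod_cast hjk
      · simp [smul_smul, div_mul_cancel₀ _ hk'.ne']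

theorem ncard_segment_inter_latt (hd : (u.1 * w.2 - u.2 * w.1) ^ 2 = 1) (k : ℕ) :
    (segment ℝ (c u) (c (u + (k : ℤ) • w)) ∩ latt).ncard = k + 1 := by
  rw [segment_inter_latt_eq_image hd, Set.ncard_image_of_injective, Set.ncard_coe_finset,
    Finset.card_range]
  intro i j hij
  have h : (1 : ℝ) • c u + (i : ℝ) • c w = (1 : ℝ) • c u + (j : ℝ) • c w := by
    simpa only [one_smul] using hij
  exact_mod_cast (coords_eq_of_combination_eq hd h).2

theorem interior_triangle_inter_latt (hd : (u.1 * w.2 - u.2 * w.1) ^ 2 = 1) (k : ℕ) :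
    interior (convexHull ℝ ({0, c u, c (u + (k : ℤ) • w)} : Set (ℝ × ℝ))) ∩ latt = ∅ := by
  rw [Set.eq_empty_iff_forall_notMem]
  rintro p ⟨hp, hpl⟩
  obtain ⟨x, y, rfl⟩ := exists_eq_of_mem_latt hd hpl
  obtain ⟨ε, hε, hadd, hsub⟩ := exists_add_sub_mem_of_mem_interior hp (c u)
  have eadd : (x : ℝ) • c u + (y : ℝ) • c w + ε • c u = (x + ε) • c u + (y : ℝ) • c w := by
    module
  have esub : (x : ℝ) • c u + (y : ℝ) • c w - ε • c u = (x - ε) • c u + (y : ℝ) • c w := by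
    module
  rw [eadd] at hadd
  rw [esub] at hsub
  have h₁ := (coord_mem_Icc_of_mem_convexHull hd k hadd).1.2
  have h₂ := (coord_mem_Icc_of_mem_convexHull hd k hsub).1.1
  have hx1 : x < 1 := by
    have : (x : ℝ) < 1 := by linarith
    exact_mod_cast this
  have hx0 : 0 < x := by
    have : (0 : ℝ) < x := by linarith
    exact_mod_cast this
  omega

theorem mem_segment_of_mem_triangle_inter_latt (hd : (u.1 * w.2 - u.2 * w.1) ^ 2 = 1) (k : ℕ)
    {p : ℝ × ℝ}
    (hp : p ∈ convexHull ℝ ({0, c u, c (u + (k : ℤ) • w)} : Set (ℝ × ℝ)) ∩ latt) (hp0 : p ≠ 0) :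
    p ∈ segment ℝ (c u) (c (u + (k : ℤ) • w)) := by
  obtain ⟨hp, hpl⟩ := hp
  obtain ⟨x, y, rfl⟩ := exists_eq_of_mem_latt hd hpl
  obtain ⟨⟨hx0, hx1⟩, hy0, hyk⟩ := coord_mem_Icc_of_mem_convexHull hd k hp
  have hx0' : 0 ≤ x := by exact_mod_cast hx0
  have hx1' : x ≤ 1 := by exact_mod_cast hx1
  have hy0' : 0 ≤ y := by exact_mod_cast hy0
  have hyk' : y ≤ x * k := by exact_mod_cast hyk
  obtain rfl | rfl : x = 0 ∨ x = 1 := by omega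
  · obtain rfl : y = 0 := by omega
    simp at hp0
  · lift y to ℕ using hy0'
    have hmem : c u + (y : ℝ) • c w ∈ segment ℝ (c u) (c (u + (k : ℤ) • w)) ∩ latt := by
      rw [segment_inter_latt_eq_image hd]
      exact ⟨y, by simp; omega, rfl⟩
    simpa using hmem.1

end Unimodular

theorem det_sq_eq_one_of_recurrence {m : ℕ} {q : ℕ → ℕ} {v : ℕ → ℤ × ℤ}
    (hv0 : v 0 = (1, 0)) (hv1 : v 1 = (0, 1))
    (hrec : ∀ i ≤ m, v (i + 2) = v i + (q i : ℤ) • v (i + 1)) :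
    ∀ i ≤ m, ((v i).1 * (v (i + 1)).2 - (v i).2 * (v (i + 1)).1) ^ 2 = 1 := by
  intro i
  induction i with
  | zero => simp [hv0, hv1]
  | succ i ih =>
    intro hi
    rw [← ih (by omega), hrec i (by omega)]
    simp
    ring

/-- For `0 ≤ i ≤ m`, the triangle `Tᵢ` with vertices `(0,0)`, `v_{i-2}`, `vᵢ` (with index
shift: `v i` is the paper's `v_{i-2}` and `v (i+2)` is the paper's `vᵢ`): the segment from
`v_{i-2}` to `vᵢ` contains exactly `qᵢ + 1` lattice points, the interior of `Tᵢ` contains no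
lattice points, and every non-vertex lattice point of `Tᵢ` lies on that segment. -/
theorem stmt_13 (a n : ℕ) (ha : 0 < a) (han : a < n) (hco : Nat.Coprime a n)
    (m : ℕ) (q : ℕ → ℕ) (v : ℕ → ℤ × ℤ)
    (hv0 : v 0 = (1, 0)) (hv1 : v 1 = (0, 1))
    (hrec : ∀ i ≤ m, v (i + 2) = v i + (q i : ℤ) • v (i + 1))
    (hq : ∀ i ≤ m, 1 ≤ q i) (hqm : 1 ≤ m → 2 ≤ q m)
    (hvm : v (m + 2) = ((a : ℤ), (n : ℤ))) :
    ∀ i ≤ m,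
      (segment ℝ (c (v i)) (c (v (i + 2))) ∩ latt).ncard = q i + 1 ∧
      interior (convexHull ℝ ({0, c (v i), c (v (i + 2))} : Set (ℝ × ℝ))) ∩ latt = ∅ ∧
      ∀ p ∈ convexHull ℝ ({0, c (v i), c (v (i + 2))} : Set (ℝ × ℝ)) ∩ latt,
        p ∉ ({0, c (v i), c (v (i + 2))} : Set (ℝ × ℝ)) →
        p ∈ segment ℝ (c (v i)) (c (v (i + 2))) := by
  intro i hi
  have hd := det_sq_eq_one_of_recurrence hv0 hv1 hrec i hi
  rw [hrec i hi]
  refine ⟨ncard_segment_inter_latt hd _, interior_triangle_inter_latt hd _, ?_⟩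
  intro p hp hpv
  exact mem_segment_of_mem_triangle_inter_latt hd _ hp fun h => hpv (Or.inl h)
end

section
/- Let a < n be coprime positive integers with continued fraction data as below. Then for every i with 0 ≤ i ≤ m−2, the determinant of the 3×3 matrix with rows (1, B_{i−2}, A_{i−2}), (1, B_i, A_i), (1, B_{i+2}, A_{i+2}) equals (−1)^{i−1} q_i q_{i+1} q_{i+2}. Consequently, traversing the piecewise linear path through the odd-indexed convergent points v_1, v_3, …, v_{O(m)} in order one always turns left, and likewise traversing v_{E(m)}, v_{E(m)−2}, …, v_0 one always turns left. -/
/-- Consecutive terms of a sequence satisfying the continued fraction recurrence have constant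
cross product up to alternating sign. -/
theorem cross_consecutive_eq_neg_one_pow {m : ℕ} {q : ℕ → ℕ} {v : ℕ → ℤ × ℤ}
    (hv0 : v 0 = (1, 0)) (hv1 : v 1 = (0, 1))
    (hrec : ∀ i ≤ m, v (i + 2) = v i + (q i : ℤ) • v (i + 1)) (i : ℕ) (hi : i ≤ m + 1) :
    (v i).1 * (v (i + 1)).2 - (v i).2 * (v (i + 1)).1 = (-1) ^ i := by
  induction i with
  | zero => simp [hv0, hv1]
  | succ k ih =>
    rw [pow_succ, ← ih (by omega), hrec k (by omega)]
    simp only [Prod.fst_add, Prod.snd_add, Prod.smul_fst, Prod.smul_snd, smul_eq_mul]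
    ring

/-- The turn at the middle of three terms of equal index parity is measured by the product of
three consecutive partial quotients, up to alternating sign. -/
theorem cross_same_parity_eq {m : ℕ} {q : ℕ → ℕ} {v : ℕ → ℤ × ℤ}
    (hv0 : v 0 = (1, 0)) (hv1 : v 1 = (0, 1))
    (hrec : ∀ i ≤ m, v (i + 2) = v i + (q i : ℤ) • v (i + 1)) (i : ℕ) (hi : i + 2 ≤ m) :
    ((v (i + 2)).1 - (v i).1) * ((v (i + 4)).2 - (v (i + 2)).2) -
        ((v (i + 2)).2 - (v i).2) * ((v (i + 4)).1 - (v (i + 2)).1) =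
      (-1 : ℤ) ^ (i + 1) * (q i : ℤ) * (q (i + 1) : ℤ) * (q (i + 2) : ℤ) := by
  rw [pow_succ, ← cross_consecutive_eq_neg_one_pow hv0 hv1 hrec i (by omega),
    hrec (i + 2) hi, hrec (i + 1) (by omega), hrec i (by omega)]
  simp only [Prod.fst_add, Prod.snd_add, Prod.smul_fst, Prod.smul_snd, smul_eq_mul]
  ring


/-- With the convergent points `vᵢ = (Bᵢ, Aᵢ)` of `n/a` (index shift by `2`: `v (i+2)` is
the paper's `vᵢ`, `v 0 = v₋₂`, `v 1 = v₋₁`), for `0 ≤ i ≤ m-2` the determinant of the matrix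
with rows `(1, B_{i-2}, A_{i-2})`, `(1, Bᵢ, Aᵢ)`, `(1, B_{i+2}, A_{i+2})` equals
`(-1)^{i-1} qᵢ q_{i+1} q_{i+2}`; consequently the piecewise linear path through the
odd-indexed convergents (in increasing order) always turns left, as does the path through
the even-indexed convergents in decreasing order. -/
theorem stmt_14 (a n : ℕ) (ha : 0 < a) (han : a < n) (hco : Nat.Coprime a n)
    (m : ℕ) (q : ℕ → ℕ) (v : ℕ → ℤ × ℤ)
    (hv0 : v 0 = (1, 0)) (hv1 : v 1 = (0, 1))
    (hrec : ∀ i ≤ m, v (i + 2) = v i + (q i : ℤ) • v (i + 1))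
    (hq : ∀ i ≤ m, 1 ≤ q i) (hqm : 1 ≤ m → 2 ≤ q m)
    (hvm : v (m + 2) = ((a : ℤ), (n : ℤ))) :
    (∀ i, i + 2 ≤ m →
      (Matrix.det !![1, (v i).1, (v i).2;
                     1, (v (i + 2)).1, (v (i + 2)).2;
                     1, (v (i + 4)).1, (v (i + 4)).2] : ℤ) =
        (-1 : ℤ) ^ (i + 1) * (q i : ℤ) * (q (i + 1) : ℤ) * (q (i + 2) : ℤ)) ∧
    (∀ i, Odd i → 3 ≤ i → i + 2 < m →
      0 < ((v (i + 2)).1 - (v i).1) * ((v (i + 4)).2 - (v (i + 2)).2) -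
          ((v (i + 2)).2 - (v i).2) * ((v (i + 4)).1 - (v (i + 2)).1)) ∧
    (∀ i, Even i → 2 ≤ i → i + 2 < m →
      0 < ((v (i + 2)).1 - (v (i + 4)).1) * ((v i).2 - (v (i + 2)).2) -
          ((v (i + 2)).2 - (v (i + 4)).2) * ((v i).1 - (v (i + 2)).1)) := by
  have hcross := cross_same_parity_eq hv0 hv1 hrec
  have hpos : ∀ i, i + 2 < m → 0 < (q i : ℤ) * (q (i + 1) : ℤ) * (q (i + 2) : ℤ) := by
    intro i hi
    have h₀ := hq i (by omega)
    have h₁ := hq (i + 1) (by omega)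
    have h₂ := hq (i + 2) (by omega)
    positivity
  refine ⟨fun i hi => ?_, fun i hodd _ hi => ?_, fun i heven _ hi => ?_⟩
  · rw [← hcross i hi, Matrix.det_fin_three]
    simp
    ring
  · rw [hcross i hi.le, hodd.add_one.neg_one_pow, one_mul]
    exact hpos i hi
  · have h := hcross i hi.le
    rw [heven.add_one.neg_one_pow] at h
    linarith [hpos i hi]
end

section
/- Let a < n be coprime positive integers with n > 1, m ≥ 1, and continued fraction data as below, and set u_i = v_i + (1,0). If m is odd (so O(m) < E(m) = m−1), then among all lattice points in the interior of P_{a,n}, the unique one at minimal distance from the line through (0,0) and (a,n) is v_{E(m)}, and the unique one at minimal distance from the line through (1,0) and (a+1,n) is u_m − v_{E(m)}. If m is even (so E(m) < O(m) = m−1), then the unique interior lattice point at minimal distance from the line through (0,0) and (a,n) is u_m − u_{O(m)}, and the unique interior lattice point at minimal distance from the line through (1,0) and (a+1,n) is u_{O(m)}. -/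
/-- The point `(x, y)` of the Euclidean plane. -/
noncomputable def e (x y : ℝ) : EuclideanSpace ℝ (Fin 2) :=
  (WithLp.equiv 2 (Fin 2 → ℝ)).symm ![x, y]

/-- The canonical embedding `ℤ² →` Euclidean plane. -/
noncomputable def cv (z : ℤ × ℤ) : EuclideanSpace ℝ (Fin 2) := e (z.1 : ℝ) (z.2 : ℝ)

/-- The set of lattice points of the Euclidean plane. -/
noncomputable def lattE : Set (EuclideanSpace ℝ (Fin 2)) := {p | ∃ z : ℤ × ℤ, p = cv z}

/-- The clean lattice parallelogram with vertices `(0,0), (1,0), (a,n), (a+1,n)`. -/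
noncomputable def PanE (a n : ℕ) : Set (EuclideanSpace ℝ (Fin 2)) :=
  convexHull ℝ {e 0 0, e 1 0, e (a : ℝ) (n : ℝ), e ((a : ℝ) + 1) (n : ℝ)}

/-- The line through `(0,0)` and `(a,n)`. -/
def line1 (a n : ℕ) : Set (EuclideanSpace ℝ (Fin 2)) :=
  {p | (n : ℝ) * p 0 = (a : ℝ) * p 1}

/-- The line through `(1,0)` and `(a+1,n)`. -/
def line2 (a n : ℕ) : Set (EuclideanSpace ℝ (Fin 2)) :=
  {p | (n : ℝ) * (p 0 - 1) = (a : ℝ) * p 1}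

open Metric in
lemma infDist_line_eq (a b c : ℝ) (hb : 0 < b) (p : EuclideanSpace ℝ (Fin 2)) :
    infDist p {p : EuclideanSpace ℝ (Fin 2) | b * (p 0 - c) = a * p 1} =
      |b * (p 0 - c) - a * p 1| / √(b ^ 2 + a ^ 2) := by
  have hpos : 0 < b ^ 2 + a ^ 2 := by positivity
  have hsq : 0 < √(b ^ 2 + a ^ 2) := Real.sqrt_pos.2 hpos
  apply le_antisymm
  · set t : ℝ := (b * (p 0 - c) - a * p 1) / (b ^ 2 + a ^ 2) with ht
    have hmem : e (p 0 - t * b) (p 1 + t * a) ∈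
        {p : EuclideanSpace ℝ (Fin 2) | b * (p 0 - c) = a * p 1} := by
      simp only [e, Set.mem_ofPred_eq, WithLp.equiv_symm_apply, Matrix.cons_val_zero,
        Matrix.cons_val_one]
      have : t * (b ^ 2 + a ^ 2) = b * (p 0 - c) - a * p 1 := by
        rw [ht]; field_simp
      linarith
    refine (infDist_le_dist_of_mem hmem).trans (le_of_eq ?_)
    rw [EuclideanSpace.dist_eq]
    simp only [e, Fin.sum_univ_two, WithLp.equiv_symm_apply, Matrix.cons_val_zero,
        Matrix.cons_val_one, Real.dist_eq, sq_abs]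
    have h1 : (p 0 - (p 0 - t * b)) ^ 2 + (p 1 - (p 1 + t * a)) ^ 2 =
        t ^ 2 * (b ^ 2 + a ^ 2) := by ring
    rw [h1, Real.sqrt_mul (sq_nonneg t), Real.sqrt_sq_eq_abs, eq_div_iff hsq.ne', mul_assoc,
      Real.mul_self_sqrt hpos.le, ht, abs_div, abs_of_pos hpos]
    field_simp
  · refine (le_infDist ⟨e c 0, by simp [e]⟩).2 fun r hr => ?_
    rw [Set.mem_ofPred_eq] at hr
    rw [EuclideanSpace.dist_eq, div_le_iff₀ hsq, ← Real.sqrt_mul (by positivity)]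
    apply Real.abs_le_sqrt
    simp only [Fin.sum_univ_two, Real.dist_eq, sq_abs]
    have h1 : b * (p 0 - c) - a * p 1 = b * (p 0 - r 0) - a * (p 1 - r 1) := by linarith
    rw [h1]
    nlinarith [sq_nonneg (a * (p 0 - r 0) + b * (p 1 - r 1))]

lemma infDist_line1 (a n : ℕ) (hn : 0 < n) (p : EuclideanSpace ℝ (Fin 2)) :
    Metric.infDist p (line1 a n) = |(n : ℝ) * p 0 - a * p 1| / √((n : ℝ) ^ 2 + (a : ℝ) ^ 2) := by
  have := infDist_line_eq a n 0 (by exact_mod_cast hn) p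
  simpa [line1] using this

lemma infDist_line2 (a n : ℕ) (hn : 0 < n) (p : EuclideanSpace ℝ (Fin 2)) :
    Metric.infDist p (line2 a n) =
      |(n : ℝ) * (p 0 - 1) - a * p 1| / √((n : ℝ) ^ 2 + (a : ℝ) ^ 2) :=
  infDist_line_eq a n 1 (by exact_mod_cast hn) p

/-- The linear form `(x, y) ↦ b x + c y` on the Euclidean plane. -/
noncomputable def planeForm (b c : ℝ) : EuclideanSpace ℝ (Fin 2) →L[ℝ] ℝ :=
  b • EuclideanSpace.proj 0 + c • EuclideanSpace.proj 1

lemma planeForm_apply (b c : ℝ) (p : EuclideanSpace ℝ (Fin 2)) :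
    planeForm b c p = b * p 0 + c * p 1 := by
  simp [planeForm]

lemma interior_planeForm_preimage_Icc (b c s t : ℝ) (h : b ≠ 0 ∨ c ≠ 0) :
    interior (planeForm b c ⁻¹' Set.Icc s t) = planeForm b c ⁻¹' Set.Ioo s t := by
  have hsurj : Function.Surjective (planeForm b c) := fun y => by
    have hpos : b ^ 2 + c ^ 2 ≠ 0 := by
      rcases h with h | h <;> positivity
    refine ⟨e (y * b / (b ^ 2 + c ^ 2)) (y * c / (b ^ 2 + c ^ 2)), ?_⟩
    simp only [planeForm_apply, e, WithLp.equiv_symm_apply, Matrix.cons_val_zero,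
        Matrix.cons_val_one]
    field_simp
  rw [← ((planeForm b c).isOpenMap hsurj).preimage_interior_eq_interior_preimage
    (planeForm b c).continuous, interior_Icc]

lemma PanE_eq (a n : ℕ) (hn : 0 < n) :
    PanE a n = planeForm 0 1 ⁻¹' Set.Icc 0 (n : ℝ) ∩
      planeForm n (-a) ⁻¹' Set.Icc 0 (n : ℝ) := by
  have hn' : (0 : ℝ) < n := by exact_mod_cast hn
  apply Set.Subset.antisymm
  · refine convexHull_min ?_ (((convex_Icc _ _).linear_preimage (planeForm 0 1).toLinearMap).inter
      ((convex_Icc _ _).linear_preimage (planeForm n (-a)).toLinearMap))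
    rintro p (rfl | rfl | rfl | rfl) <;>
      simp only [Set.mem_inter_iff, Set.mem_preimage, Set.mem_Icc, planeForm_apply, e,
        WithLp.equiv_symm_apply, Matrix.cons_val_zero, Matrix.cons_val_one] <;>
      refine ⟨⟨?_, ?_⟩, ?_, ?_⟩ <;> linarith
  · rintro p ⟨⟨h1, h2⟩, h3, h4⟩
    rw [planeForm_apply] at h1 h2 h3 h4
    set s : ℝ := p 1 / n with hs
    set t : ℝ := (n * p 0 - a * p 1) / n with ht
    have hs0 : 0 ≤ s := div_nonneg (by linarith) hn'.le
    have hs1 : s ≤ 1 := (div_le_one hn').2 (by linarith)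
    have ht0 : 0 ≤ t := div_nonneg (by linarith) hn'.le
    have ht1 : t ≤ 1 := (div_le_one hn').2 (by linarith)
    have hconv : Convex ℝ (PanE a n) := convex_convexHull ℝ _
    have hsub : _ ⊆ PanE a n := subset_convexHull ℝ _
    have hA : (1 - t) • e 0 0 + t • e 1 0 ∈ PanE a n :=
      hconv (hsub (by simp)) (hsub (by simp)) (by linarith) ht0 (by ring)
    have hB : (1 - t) • e a n + t • e (a + 1) n ∈ PanE a n :=
      hconv (hsub (by simp)) (hsub (by simp)) (by linarith) ht0 (by ring)
    have hC := hconv hA hB (sub_nonneg.2 hs1) hs0 (by ring)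
    convert hC using 1
    ext i
    fin_cases i <;>
      simp [e, hs, ht] <;> field_simp <;> ring

lemma cv_mem_interior_iff (a n : ℕ) (hn : 0 < n) (z : ℤ × ℤ) :
    cv z ∈ interior (PanE a n) ↔
      (0 < z.2 ∧ z.2 < n) ∧ 0 < n * z.1 - a * z.2 ∧ n * z.1 - a * z.2 < n := by
  have hn' : (n : ℝ) ≠ 0 := by exact_mod_cast hn.ne'
  rw [PanE_eq a n hn, interior_inter, interior_planeForm_preimage_Icc _ _ _ _ (Or.inr one_ne_zero),
    interior_planeForm_preimage_Icc _ _ _ _ (Or.inl hn')]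
  simp only [Set.mem_inter_iff, Set.mem_preimage, Set.mem_Ioo, planeForm_apply, cv, e,
    WithLp.equiv_symm_apply, Matrix.cons_val_zero, Matrix.cons_val_one, zero_mul, zero_add,
    one_mul, neg_mul, ← sub_eq_add_neg]
  norm_cast

lemma eq_of_cross_eq {a n : ℕ} (hco : Nat.Coprime a n) {z w : ℤ × ℤ}
    (hz : 0 < z.2 ∧ z.2 < n) (hw : 0 < w.2 ∧ w.2 < n)
    (h : n * z.1 - a * z.2 = n * w.1 - a * w.2) : z = w := by
  have hdvd : (n : ℤ) ∣ a * (z.2 - w.2) := ⟨z.1 - w.1, by linarith⟩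
  have hdvd' : (n : ℤ) ∣ z.2 - w.2 :=
    (Nat.isCoprime_iff_coprime.2 hco.symm).dvd_of_dvd_mul_left hdvd
  have h2 : z.2 = w.2 := by
    have := Int.eq_zero_of_abs_lt_dvd hdvd' (by rw [abs_lt]; constructor <;> linarith)
    linarith
  rw [h2] at h
  have hn : (n : ℤ) ≠ 0 := by linarith
  exact Prod.ext (mul_left_cancel₀ hn (by linarith)) h2

lemma closest_line1 {a n : ℕ} (hn : 1 < n) (hco : Nat.Coprime a n) {z : ℤ × ℤ}
    (hz : 0 < z.2 ∧ z.2 < n) (h : n * z.1 - a * z.2 = 1) :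
    cv z ∈ interior (PanE a n) ∩ lattE ∧
      ∀ p ∈ interior (PanE a n) ∩ lattE, p ≠ cv z →
        Metric.infDist (cv z) (line1 a n) < Metric.infDist p (line1 a n) := by
  have hn0 : 0 < n := by lia
  refine ⟨⟨(cv_mem_interior_iff a n hn0 z).2 ⟨hz, by lia, by lia⟩, z, rfl⟩, ?_⟩
  rintro p ⟨hp, w, rfl⟩ hne
  obtain ⟨hw, hw1, -⟩ := (cv_mem_interior_iff a n hn0 w).1 hp
  have hlt : |n * z.1 - a * z.2| < |n * w.1 - a * w.2| := by
    rw [abs_of_pos hw1, h, abs_one]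
    refine lt_of_le_of_ne (by lia) fun h' => hne ?_
    rw [eq_of_cross_eq hco hw hz (by lia)]
  rw [infDist_line1 a n hn0, infDist_line1 a n hn0]
  refine div_lt_div_of_pos_right ?_ (by positivity)
  simp only [cv, e, WithLp.equiv_symm_apply, Matrix.cons_val_zero, Matrix.cons_val_one]
  exact_mod_cast hlt

lemma closest_line2 {a n : ℕ} (hn : 1 < n) (hco : Nat.Coprime a n) {z : ℤ × ℤ}
    (hz : 0 < z.2 ∧ z.2 < n) (h : n * (z.1 - 1) - a * z.2 = -1) :
    cv z ∈ interior (PanE a n) ∩ lattE ∧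
      ∀ p ∈ interior (PanE a n) ∩ lattE, p ≠ cv z →
        Metric.infDist (cv z) (line2 a n) < Metric.infDist p (line2 a n) := by
  have hn0 : 0 < n := by lia
  refine ⟨⟨(cv_mem_interior_iff a n hn0 z).2 ⟨hz, by linarith, by linarith⟩, z, rfl⟩, ?_⟩
  rintro p ⟨hp, w, rfl⟩ hne
  obtain ⟨hw, -, hw2⟩ := (cv_mem_interior_iff a n hn0 w).1 hp
  have hlt : |n * (z.1 - 1) - a * z.2| < |n * (w.1 - 1) - a * w.2| := by
    have hneg : n * (w.1 - 1) - a * w.2 < 0 := by linarith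
    rw [abs_of_neg hneg, h, abs_neg, abs_one]
    refine lt_of_le_of_ne (by lia) fun h' => hne ?_
    rw [eq_of_cross_eq hco hw hz (by linarith)]
  rw [infDist_line2 a n hn0, infDist_line2 a n hn0]
  refine div_lt_div_of_pos_right ?_ (by positivity)
  simp only [cv, e, WithLp.equiv_symm_apply, Matrix.cons_val_zero, Matrix.cons_val_one]
  exact_mod_cast hlt

lemma convergent_invariants {m : ℕ} {q : ℕ → ℕ} {v : ℕ → ℤ × ℤ}
    (hv0 : v 0 = (1, 0)) (hv1 : v 1 = (0, 1))
    (hrec : ∀ i ≤ m, v (i + 2) = v i + (q i : ℤ) • v (i + 1)) (hq : ∀ i ≤ m, 1 ≤ q i) :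
    ∀ i ≤ m + 1, (v i).1 * (v (i + 1)).2 - (v i).2 * (v (i + 1)).1 = (-1) ^ i ∧
      0 ≤ (v i).2 ∧ 0 < (v (i + 1)).2 ∧ (1 ≤ i → 0 < (v i).2) := by
  intro i
  induction i with
  | zero => simp [hv0, hv1]
  | succ k ih =>
    intro hk
    obtain ⟨hdet, h0, h1, -⟩ := ih (by lia)
    have hr := hrec k (by lia)
    have hqk : (1 : ℤ) ≤ q k := by exact_mod_cast hq k (by lia)
    rw [show k + 1 + 1 = k + 2 from rfl, hr]
    simp only [Prod.fst_add, Prod.snd_add, Prod.smul_fst, Prod.smul_snd, smul_eq_mul]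
    exact ⟨by rw [pow_succ, ← hdet]; ring, h1.le, by positivity, fun _ => h1⟩

/-- Among the lattice points interior to `P_{a,n}`: if `m` is odd, `v_{E(m)} = v_{m-1}`
(Lean index `v (m+1)`) is the unique point closest to the line through `(0,0), (a,n)` and
`u_m - v_{m-1}` the unique point closest to the line through `(1,0), (a+1,n)`; if `m` is
even, the roles are played by `u_m - u_{m-1}` and `u_{m-1}` respectively
(`uᵢ = vᵢ + (1,0)`, `u_m = (a+1,n)`). -/
theorem stmt_16 (a n : ℕ) (ha : 0 < a) (han : a < n) (hn : 1 < n)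
    (hco : Nat.Coprime a n)
    (m : ℕ) (hm : 1 ≤ m) (q : ℕ → ℕ) (v : ℕ → ℤ × ℤ)
    (hv0 : v 0 = (1, 0)) (hv1 : v 1 = (0, 1))
    (hrec : ∀ i ≤ m, v (i + 2) = v i + (q i : ℤ) • v (i + 1))
    (hq : ∀ i ≤ m, 1 ≤ q i) (hqm : 2 ≤ q m)
    (hvm : v (m + 2) = ((a : ℤ), (n : ℤ))) :
    (Odd m →
      (cv (v (m + 1)) ∈ interior (PanE a n) ∩ lattE ∧
        ∀ p ∈ interior (PanE a n) ∩ lattE, p ≠ cv (v (m + 1)) →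
          Metric.infDist (cv (v (m + 1))) (line1 a n) < Metric.infDist p (line1 a n)) ∧
      (cv (((a : ℤ) + 1, (n : ℤ)) - v (m + 1)) ∈ interior (PanE a n) ∩ lattE ∧
        ∀ p ∈ interior (PanE a n) ∩ lattE, p ≠ cv (((a : ℤ) + 1, (n : ℤ)) - v (m + 1)) →
          Metric.infDist (cv (((a : ℤ) + 1, (n : ℤ)) - v (m + 1))) (line2 a n) <
            Metric.infDist p (line2 a n))) ∧
    (Even m →
      (cv (((a : ℤ) + 1, (n : ℤ)) - (v (m + 1) + (1, 0))) ∈ interior (PanE a n) ∩ lattE ∧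
        ∀ p ∈ interior (PanE a n) ∩ lattE,
          p ≠ cv (((a : ℤ) + 1, (n : ℤ)) - (v (m + 1) + (1, 0))) →
          Metric.infDist (cv (((a : ℤ) + 1, (n : ℤ)) - (v (m + 1) + (1, 0)))) (line1 a n) <
            Metric.infDist p (line1 a n)) ∧
      (cv (v (m + 1) + (1, 0)) ∈ interior (PanE a n) ∩ lattE ∧
        ∀ p ∈ interior (PanE a n) ∩ lattE, p ≠ cv (v (m + 1) + (1, 0)) →
          Metric.infDist (cv (v (m + 1) + (1, 0))) (line2 a n) <
            Metric.infDist p (line2 a n))) := by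
  obtain ⟨hdet, -, -, hy⟩ := convergent_invariants hv0 hv1 hrec hq (m + 1) le_rfl
  have hy0 : 0 < (v (m + 1)).2 := hy (by lia)
  have hyn : (v (m + 1)).2 < n := by
    obtain ⟨-, h0, -, -⟩ := convergent_invariants hv0 hv1 hrec hq m (by lia)
    have hr := congrArg Prod.snd (hrec m le_rfl)
    rw [hvm] at hr
    simp only [Prod.snd_add, Prod.smul_snd, smul_eq_mul] at hr
    have hqm' : (2 : ℤ) ≤ q m := by exact_mod_cast hqm
    nlinarith
  rw [show m + 1 + 1 = m + 2 from rfl, hvm] at hdet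
  dsimp only at hdet
  constructor
  · intro hodd
    rw [hodd.add_one.neg_one_pow] at hdet
    refine ⟨closest_line1 hn hco ⟨hy0, hyn⟩ (by linarith), closest_line2 hn hco ?_ ?_⟩
    · simp only [Prod.snd_sub]; constructor <;> linarith
    · simp only [Prod.snd_sub, Prod.fst_sub]; linarith
  · intro heven
    rw [heven.add_one.neg_one_pow] at hdet
    refine ⟨closest_line1 hn hco ?_ ?_, closest_line2 hn hco ?_ ?_⟩
    · simp only [Prod.snd_sub, Prod.snd_add]; constructor <;> linarith
    · simp only [Prod.snd_sub, Prod.fst_sub, Prod.snd_add, Prod.fst_add]; linarith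
    · simp only [Prod.snd_add]; constructor <;> linarith
    · simp only [Prod.snd_add, Prod.fst_add]; linarith
end
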